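/- Let γ > 0, λ₁ > 0, α ∈ (0,1) be fixed. There exists T₀ = T₀(γ, α, λ₁) ≥ 1 such that for every t₀ with T₀ ≤ t₀ and every λ ≥ λ₁, the partial derivative of B_α(λ, t₀) with respect to α is strictly negative: ∂_α B_α(λ, t₀) < 0. -/

import Mathlib

open Real MeasureTheory Set
open Filter Topology

/-- The complex number whose squared modulus is the denominator of the kernel. -/
noncomputable def symbolDenom (γ lam r a : ℝ) : ℂ :=
  (lam - r : ℝ) + lam * γ * Complex.exp (a * (Real.log r + π * Complex.I))

/-- The derivative of the kernel with respect to the exponent. -/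
noncomputable def kernelDeriv (γ lam r a : ℝ) : ℝ :=
  1 / π * (lam * γ * (Complex.exp (a * (Real.log r + π * Complex.I)) *
    (Real.log r + π * Complex.I)) / symbolDenom γ lam r a ^ 2).im

lemma exp_mul_log_add_pi (r a : ℝ) (hr : 0 < r) :
    Complex.exp (a * (Real.log r + π * Complex.I)) =
      ((r ^ a * Real.cos (a * π) : ℝ) : ℂ) + ((r ^ a * Real.sin (a * π) : ℝ) : ℂ) * Complex.I := by
  have h : (a * (Real.log r + π * Complex.I) : ℂ) =
      ((Real.log r * a : ℝ) : ℂ) + ((a * π : ℝ) : ℂ) * Complex.I := by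
    push_cast; ring
  rw [h, Complex.exp_add, Complex.exp_mul_I, ← Complex.ofReal_exp, ← Real.rpow_def_of_pos hr,
    ← Complex.ofReal_cos, ← Complex.ofReal_sin]
  push_cast; ring

lemma norm_exp_mul_log_add_pi (r a : ℝ) (hr : 0 < r) :
    ‖Complex.exp (a * (Real.log r + π * Complex.I))‖ = r ^ a := by
  rw [Complex.norm_exp, Real.rpow_def_of_pos hr]
  congr 1
  simp [mul_comm]

lemma symbolDenom_re (γ lam r a : ℝ) (hr : 0 < r) :
    (symbolDenom γ lam r a).re = -r + lam * γ * r ^ a * Real.cos (a * π) + lam := by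
  rw [symbolDenom, exp_mul_log_add_pi r a hr, Complex.add_re, ← Complex.ofReal_mul,
    Complex.re_ofReal_mul, Complex.ofReal_re]
  simp only [Complex.add_re, Complex.ofReal_re, Complex.re_ofReal_mul, Complex.I_re]
  ring

lemma symbolDenom_im (γ lam r a : ℝ) (hr : 0 < r) :
    (symbolDenom γ lam r a).im = lam * γ * r ^ a * Real.sin (a * π) := by
  rw [symbolDenom, exp_mul_log_add_pi r a hr, Complex.add_im, ← Complex.ofReal_mul,
    Complex.im_ofReal_mul, Complex.ofReal_im]
  simp only [Complex.add_im, Complex.ofReal_im, Complex.im_ofReal_mul, Complex.I_im]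
  ring

lemma kernel_eq_neg_inv_symbolDenom_im (γ lam r a : ℝ) (hr : 0 < r) :
    (γ / π) * (lam * r ^ a * Real.sin (a * π)) /
      ((-r + lam * γ * r ^ a * Real.cos (a * π) + lam) ^ 2
        + (lam * γ * r ^ a * Real.sin (a * π)) ^ 2) = -(1 / π) * ((symbolDenom γ lam r a)⁻¹).im := by
  rw [Complex.inv_im, Complex.normSq_apply, symbolDenom_re _ _ _ _ hr, symbolDenom_im _ _ _ _ hr]
  simp only [div_eq_mul_inv, ← sq]
  ring

lemma le_norm_symbolDenom (γ lam r a : ℝ) (hr : 0 < r) :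
    lam * γ * r ^ a * Real.sin (a * π) ≤ ‖symbolDenom γ lam r a‖ := by
  rw [← symbolDenom_im γ lam r a hr]
  exact (le_abs_self _).trans (Complex.abs_im_le_norm _)

lemma sin_mul_pi_pos {a : ℝ} (ha : a ∈ Ioo (0 : ℝ) 1) : 0 < Real.sin (a * π) :=
  Real.sin_pos_of_pos_of_lt_pi (mul_pos ha.1 Real.pi_pos)
    (by nlinarith [ha.2, Real.pi_pos])

lemma symbolDenom_ne_zero {γ lam r a : ℝ} (hγ : 0 < γ) (hlam : 0 < lam) (hr : 0 < r)
    (ha : a ∈ Ioo (0 : ℝ) 1) : symbolDenom γ lam r a ≠ 0 := by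
  rw [← norm_pos_iff]
  have := sin_mul_pi_pos ha
  exact lt_of_lt_of_le (by positivity) (le_norm_symbolDenom γ lam r a hr)

lemma hasDerivAt_kernel {γ lam r a : ℝ} (hγ : 0 < γ) (hlam : 0 < lam) (hr : 0 < r)
    (ha : a ∈ Ioo (0 : ℝ) 1) :
    HasDerivAt (fun a : ℝ => (γ / π) * (lam * r ^ a * Real.sin (a * π)) /
      ((-r + lam * γ * r ^ a * Real.cos (a * π) + lam) ^ 2
        + (lam * γ * r ^ a * Real.sin (a * π)) ^ 2)) (kernelDeriv γ lam r a) a := by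
  have h1 : HasDerivAt (fun x : ℝ => symbolDenom γ lam r x)
      (lam * γ * (Complex.exp (a * (Real.log r + π * Complex.I)) *
        (Real.log r + π * Complex.I))) a := by
    have h0 : HasDerivAt (fun x : ℝ => (x : ℂ) * (Real.log r + π * Complex.I))
        (1 * (Real.log r + π * Complex.I)) a :=
      (HasDerivAt.ofReal_comp (hasDerivAt_id a)).mul_const _
    have h := (h0.cexp.const_mul (lam * γ : ℂ)).const_add (((lam - r : ℝ)) : ℂ)
    simpa only [symbolDenom, one_mul] using h
  have h2 := h1.inv (symbolDenom_ne_zero hγ hlam hr ha)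
  have h3 := ((Complex.imCLM.hasFDerivAt.comp_hasDerivAt a h2).const_mul (-(1 / π)))
  refine (h3.congr_deriv ?_).congr_of_eventuallyEq
    (.of_forall fun x => kernel_eq_neg_inv_symbolDenom_im γ lam r x hr)
  simp only [kernelDeriv, Complex.imCLM_apply, neg_div, Complex.neg_im]
  ring

lemma norm_log_add_pi_le (r : ℝ) : ‖(Real.log r + π * Complex.I : ℂ)‖ ≤ |Real.log r| + π := by
  refine (norm_add_le _ _).trans ?_
  simp [abs_of_pos Real.pi_pos]

lemma abs_kernelDeriv_le {γ lam r a : ℝ} (hγ : 0 < γ) (hlam : 0 < lam) (hr : 0 < r)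
    (ha : a ∈ Ioo (0 : ℝ) 1) :
    |kernelDeriv γ lam r a| ≤
      1 / (π * lam * γ * Real.sin (a * π) ^ 2) * ((|Real.log r| + π) * r ^ (-a)) := by
  have hs := sin_mul_pi_pos ha
  have hra : 0 < r ^ a := Real.rpow_pos_of_pos hr a
  have hW := le_norm_symbolDenom γ lam r a hr
  have hpos : 0 < lam * γ * r ^ a * Real.sin (a * π) := by positivity
  rw [kernelDeriv, abs_mul, abs_of_pos (by positivity : (0 : ℝ) < 1 / π)]
  calc 1 / π * |_| ≤ 1 / π * ‖(lam * γ * (Complex.exp (a * (Real.log r + π * Complex.I)) *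
    (Real.log r + π * Complex.I)) / symbolDenom γ lam r a ^ 2)‖ := by
        gcongr; exact Complex.abs_im_le_norm _
    _ = 1 / π * (lam * γ * (r ^ a * ‖(Real.log r + π * Complex.I : ℂ)‖) /
          ‖symbolDenom γ lam r a‖ ^ 2) := by
        rw [norm_div, norm_pow, norm_mul, norm_mul, norm_mul, norm_exp_mul_log_add_pi r a hr,
          Complex.norm_of_nonneg hlam.le, Complex.norm_of_nonneg hγ.le]
    _ ≤ 1 / π * (lam * γ * (r ^ a * (|Real.log r| + π)) /
          (lam * γ * r ^ a * Real.sin (a * π)) ^ 2) := by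
        gcongr; exact norm_log_add_pi_le r
    _ = _ := by
        rw [Real.rpow_neg hr.le]
        field_simp

lemma abs_kernel_le {γ lam r a : ℝ} (hγ : 0 < γ) (hlam : 0 < lam) (hr : 0 < r)
    (ha : a ∈ Ioo (0 : ℝ) 1) :
    |(γ / π) * (lam * r ^ a * Real.sin (a * π)) /
      ((-r + lam * γ * r ^ a * Real.cos (a * π) + lam) ^ 2
        + (lam * γ * r ^ a * Real.sin (a * π)) ^ 2)| ≤
      1 / (π * lam * γ * Real.sin (a * π)) * r ^ (-a) := by
  have hs := sin_mul_pi_pos ha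
  have hra : 0 < r ^ a := Real.rpow_pos_of_pos hr a
  have hW := le_norm_symbolDenom γ lam r a hr
  have hpos : 0 < lam * γ * r ^ a * Real.sin (a * π) := by positivity
  rw [kernel_eq_neg_inv_symbolDenom_im _ _ _ _ hr, abs_mul, abs_neg,
    abs_of_pos (by positivity : (0 : ℝ) < 1 / π)]
  calc 1 / π * |_| ≤ 1 / π * ‖(symbolDenom γ lam r a)⁻¹‖ := by
        gcongr; exact Complex.abs_im_le_norm _
    _ ≤ 1 / π * (lam * γ * r ^ a * Real.sin (a * π))⁻¹ := by
        rw [norm_inv]; gcongr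
    _ = _ := by
        rw [Real.rpow_neg hr.le]
        field_simp

lemma abs_log_le_rpow_add_rpow {r δ : ℝ} (hr : 0 < r) (hδ : 0 < δ) :
    |Real.log r| ≤ (r ^ δ + r ^ (-δ)) / δ := by
  have h1 := Real.log_le_rpow_div hr.le hδ
  have h2 := Real.log_le_rpow_div (inv_pos.2 hr).le hδ
  rw [Real.log_inv, Real.inv_rpow hr.le, ← Real.rpow_neg hr.le] at h2
  have h3 : 0 ≤ r ^ δ / δ := by positivity
  have h4 : 0 ≤ r ^ (-δ) / δ := by positivity
  rw [add_div, abs_le]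
  constructor <;> linarith

lemma rpow_neg_le_one_add {r a β : ℝ} (hr : 0 < r) (ha : 0 ≤ a) (hβ : a ≤ β) :
    r ^ (-a) ≤ 1 + r ^ (-β) := by
  have hb : 0 < r ^ (-β) := Real.rpow_pos_of_pos hr _
  rcases le_total r 1 with h | h
  · linarith [Real.rpow_le_rpow_of_exponent_ge hr h (neg_le_neg hβ)]
  · linarith [Real.rpow_le_one_of_one_le_of_nonpos h (neg_nonpos.2 ha)]

/-- An explicit majorant, integrable against `exp (-r)` when `β + δ < 1`. -/
noncomputable def logPowerMajorant (β δ r : ℝ) : ℝ :=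
  ((r ^ δ + r ^ (-δ)) / δ + π) * (1 + r ^ (-β))

lemma abs_log_add_pi_mul_rpow_neg_le {r a β δ : ℝ} (hr : 0 < r) (hδ : 0 < δ) (ha : 0 ≤ a)
    (hβ : a ≤ β) : (|Real.log r| + π) * r ^ (-a) ≤ logPowerMajorant β δ r := by
  unfold logPowerMajorant
  have := abs_log_le_rpow_add_rpow hr hδ
  have := rpow_neg_le_one_add hr ha hβ
  gcongr

lemma logPowerMajorant_nonneg {β δ r : ℝ} (hr : 0 < r) (hδ : 0 < δ) :
    0 ≤ logPowerMajorant β δ r := by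
  unfold logPowerMajorant; positivity

lemma integrableOn_exp_neg_mul_rpow {p : ℝ} (hp : -1 < p) :
    IntegrableOn (fun r : ℝ => Real.exp (-r) * r ^ p) (Ioi 0) := by
  simpa using Real.GammaIntegral_convergent (s := p + 1) (by linarith)

lemma integrableOn_exp_neg_mul_logPowerMajorant {β δ : ℝ} (hβ : 0 < β) (hδ : 0 < δ)
    (h : β + δ < 1) :
    IntegrableOn (fun r : ℝ => Real.exp (-r) * logPowerMajorant β δ r) (Ioi 0) := by
  have h1 := (integrableOn_exp_neg_mul_rpow (p := δ) (by linarith)).div_const δ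
  have h2 := (integrableOn_exp_neg_mul_rpow (p := -δ) (by linarith)).div_const δ
  have h3 := (integrableOn_exp_neg_mul_rpow (p := 0) (by linarith)).mul_const π
  have h4 := (integrableOn_exp_neg_mul_rpow (p := δ - β) (by linarith)).div_const δ
  have h5 := (integrableOn_exp_neg_mul_rpow (p := -δ - β) (by linarith)).div_const δ
  have h6 := (integrableOn_exp_neg_mul_rpow (p := -β) (by linarith)).mul_const π
  refine IntegrableOn.congr_fun (((((h1.add h2).add h3).add h4).add h5).add h6) ?_
    measurableSet_Ioi
  intro r (hr : 0 < r)
  simp only [Pi.add_apply, logPowerMajorant, sub_eq_add_neg, Real.rpow_add hr, Real.rpow_zero]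
  ring

lemma measurable_kernelDeriv (γ lam a : ℝ) : Measurable fun r => kernelDeriv γ lam r a := by
  unfold kernelDeriv symbolDenom
  fun_prop

/-- Near `r = 0` the derivative of the kernel is negative, uniformly for `lam1 ≤ lam`. -/
lemma exists_kernelDeriv_le_neg {γ lam1 α : ℝ} (hγ : 0 < γ) (hlam1 : 0 < lam1)
    (hα : α ∈ Ioo (0 : ℝ) 1) :
    ∃ c > 0, ∃ k > 0, ∀ r ∈ Ioo 0 c, ∀ lam, lam1 ≤ lam →
      kernelDeriv γ lam r α ≤ -(k * r) / lam := by
  have hs := sin_mul_pi_pos hα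
  let φ : ℝ × ℂ → ℝ := fun p =>
    (Complex.exp (α * (π * Complex.I)) * (-1 + p.1 * (π * Complex.I)) / p.2 ^ 2).im
  have hφ : ContinuousAt φ (0, 1) := by
    refine Complex.continuous_im.continuousAt.comp (ContinuousAt.div ?_ ?_ ?_)
    · fun_prop
    · fun_prop
    · simp
  have hφ0 : φ (0, 1) = -Real.sin (α * π) := by
    have : (α * (π * Complex.I) : ℂ) = ((α * π : ℝ) : ℂ) * Complex.I := by push_cast; ring
    simp only [φ, this, Complex.exp_mul_I, ← Complex.ofReal_cos, ← Complex.ofReal_sin]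
    simp [-Complex.ofReal_cos, -Complex.ofReal_sin]
  have hev : ∀ᶠ p in 𝓝 ((0 : ℝ), (1 : ℂ)), φ p < -(Real.sin (α * π) / 2) :=
    hφ.eventually_lt_const (by rw [hφ0]; linarith)
  obtain ⟨ε, hε, hball⟩ := Metric.eventually_nhds_iff.1 hev
  have t1 : ∀ᶠ r in 𝓝[>] (0 : ℝ), (-Real.log r)⁻¹ < ε :=
    (tendsto_inv_atTop_zero.comp
      (tendsto_neg_atBot_atTop.comp Real.tendsto_log_nhdsGT_zero)).eventually_lt_const hε
  have t2 : ∀ᶠ r in 𝓝[>] (0 : ℝ), r / lam1 + γ * r ^ α < ε := by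
    have : ContinuousAt (fun r : ℝ => r / lam1 + γ * r ^ α) 0 := by
      refine (continuousAt_id.div_const _).add (continuousAt_const.mul ?_)
      exact Real.continuousAt_rpow_const _ _ (Or.inr hα.1.le)
    refine (this.eventually_lt_const ?_).filter_mono nhdsWithin_le_nhds
    simpa [Real.zero_rpow hα.1.ne'] using hε
  have t3 : ∀ᶠ r in 𝓝[>] (0 : ℝ), Real.log r < -1 :=
    Real.tendsto_log_nhdsGT_zero.eventually_lt_atBot (-1)
  obtain ⟨c, hc, hcr⟩ := mem_nhdsGT_iff_exists_Ioo_subset.1 (t1.and (t2.and t3))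
  refine ⟨c, hc, γ * Real.sin (α * π) / (2 * π), by positivity, fun r hr lam hlam => ?_⟩
  obtain ⟨h1, h2, h3⟩ := hcr hr
  have hr0 : 0 < r := hr.1
  have hl : 0 < lam := hlam1.trans_le hlam
  have hlog : 0 < -Real.log r := by linarith
  have hr1 : r ≤ 1 := by
    by_contra! h
    linarith [Real.log_pos h]
  let w : ℂ := symbolDenom γ lam r α / lam
  have hw : ‖w - 1‖ < ε := by
    have : w - 1 = -((r / lam : ℝ) : ℂ) +
        γ * Complex.exp (α * (Real.log r + π * Complex.I)) := by
      have : (lam : ℂ) ≠ 0 := by exact_mod_cast hl.ne'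
      simp only [w, symbolDenom]
      push_cast
      field_simp
      ring
    rw [this]
    refine (norm_add_le _ _).trans_lt (lt_of_le_of_lt ?_ h2)
    rw [norm_neg, norm_mul, norm_exp_mul_log_add_pi r α hr0, Complex.norm_of_nonneg hγ.le,
      Complex.norm_of_nonneg (by positivity)]
    gcongr
  have hφw : φ ((-Real.log r)⁻¹, w) < -(Real.sin (α * π) / 2) := by
    apply hball
    rw [Prod.dist_eq]
    refine max_lt ?_ ?_
    · rw [Real.dist_eq, sub_zero, abs_of_pos (inv_pos.2 hlog)]
      exact h1
    · rwa [dist_eq_norm]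
  have hK : kernelDeriv γ lam r α =
      γ / (π * lam) * (r ^ α * -Real.log r) * φ ((-Real.log r)⁻¹, w) := by
    have hexp : Complex.exp (α * (Real.log r + π * Complex.I)) =
        ((r ^ α : ℝ) : ℂ) * Complex.exp (α * (π * Complex.I)) := by
      rw [mul_add, Complex.exp_add, Real.rpow_def_of_pos hr0, mul_comm (Real.log r)]
      push_cast
      rfl
    have hl' : (lam : ℂ) ≠ 0 := by exact_mod_cast hl.ne'
    have hlog' : (Real.log r : ℂ) ≠ 0 := by exact_mod_cast (by linarith : Real.log r < 0).ne
    have hD : symbolDenom γ lam r α = lam * w := by simp only [w]; field_simp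
    have hw0 : w ≠ 0 := by
      intro h0
      exact symbolDenom_ne_zero hγ hl hr0 hα (by rw [hD, h0, mul_zero])
    simp only [kernelDeriv, φ]
    rw [hD, hexp, ← Complex.im_ofReal_mul, ← Complex.im_ofReal_mul]
    congr 1
    have hpi : (π : ℂ) ≠ 0 := by exact_mod_cast Real.pi_ne_zero
    push_cast
    field_simp
    ring
  rw [hK]
  have hrα : r ≤ r ^ α := by
    simpa using Real.rpow_le_rpow_of_exponent_ge hr0 hr1 hα.2.le
  have hm : r ≤ r ^ α * -Real.log r := by nlinarith
  calc γ / (π * lam) * (r ^ α * -Real.log r) * φ ((-Real.log r)⁻¹, w)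
      ≤ γ / (π * lam) * (r ^ α * -Real.log r) * -(Real.sin (α * π) / 2) := by
        have : 0 < r ^ α := Real.rpow_pos_of_pos hr0 α
        gcongr
    _ ≤ γ / (π * lam) * r * -(Real.sin (α * π) / 2) := by
        have : γ / (π * lam) * r ≤ γ / (π * lam) * (r ^ α * -Real.log r) := by gcongr
        nlinarith
    _ = _ := by field_simp

/-- If `f` is negative near `0` and dominated away from `0`, its Laplace transform is negative
at every large argument, uniformly in `f`. -/
lemma exists_forall_integral_exp_mul_neg {G : ℝ → ℝ} (hG : ∀ r, 0 < r → 0 ≤ G r)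
    (hGi : IntegrableOn (fun r => Real.exp (-r) * G r) (Ioi 0)) {c k : ℝ} (hc : 0 < c)
    (hk : 0 < k) :
    ∃ T : ℝ, 1 ≤ T ∧ ∀ t, T ≤ t → ∀ f : ℝ → ℝ,
      IntegrableOn (fun r => Real.exp (-(r * t)) * f r) (Ioi 0) →
      (∀ r ∈ Ioo 0 c, f r ≤ -(k * r)) → (∀ r, c ≤ r → f r ≤ G r) →
      ∫ r in Ioi (0 : ℝ), Real.exp (-(r * t)) * f r < 0 := by
  set M := ∫ r in Ioi (0 : ℝ), Real.exp (-r) * G r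
  have hlim : ∀ᶠ t in atTop, Real.exp c * M * Real.exp (-(c / 2 * t)) < k * c ^ 2 / 8 := by
    have h : Tendsto (fun t : ℝ => Real.exp c * M * Real.exp (-(c / 2 * t))) atTop
        (𝓝 (Real.exp c * M * 0)) :=
      (Real.tendsto_exp_neg_atTop_nhds_zero.comp
        (tendsto_id.const_mul_atTop (half_pos hc))).const_mul _
    rw [mul_zero] at h
    exact h.eventually_lt_const (by positivity)
  obtain ⟨T, hT⟩ := eventually_atTop.1 hlim
  refine ⟨max T 1, le_max_right _ _, fun t ht f hf hneg hle => ?_⟩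
  have ht1 : 1 ≤ t := (le_max_right _ _).trans ht
  have hTt := hT t ((le_max_left _ _).trans ht)
  let g1 : ℝ → ℝ := (Ioc 0 (c / 2)).indicator fun r => Real.exp (-(c / 2 * t)) * -(k * r)
  let g2 : ℝ → ℝ := fun r => Real.exp (-(c * (t - 1))) * (Real.exp (-r) * G r)
  have i1 : IntegrableOn (fun r : ℝ => Real.exp (-(c / 2 * t)) * -(k * r)) (Ioc 0 (c / 2)) :=
    (Continuous.integrableOn_Icc (by fun_prop)).mono_set Ioc_subset_Icc_self
  have hg1 : IntegrableOn g1 (Ioi 0) :=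
    (i1.integrable_indicator measurableSet_Ioc).integrableOn
  have hg2 : IntegrableOn g2 (Ioi 0) := hGi.const_mul _
  have hpt : ∀ r ∈ Ioi (0 : ℝ), Real.exp (-(r * t)) * f r ≤ g1 r + g2 r := by
    intro r (hr : 0 < r)
    have hg2r : 0 ≤ g2 r := by
      have := hG r hr
      positivity
    rcases lt_or_ge r c with hrc | hrc
    · have hfr := hneg r ⟨hr, hrc⟩
      by_cases hr2 : r ≤ c / 2
      · have : g1 r = Real.exp (-(c / 2 * t)) * -(k * r) :=
          indicator_of_mem (show r ∈ Ioc 0 (c / 2) from ⟨hr, hr2⟩) _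
        have he : Real.exp (-(c / 2 * t)) ≤ Real.exp (-(r * t)) := by gcongr
        have hkr : 0 < k * r := by positivity
        rw [this]
        nlinarith [Real.exp_pos (-(r * t))]
      · have : g1 r = 0 := indicator_of_notMem (fun h => hr2 h.2) _
        have hkr : 0 < k * r := by positivity
        rw [this]
        nlinarith [Real.exp_pos (-(r * t))]
    · have : g1 r = 0 := indicator_of_notMem (fun h => by linarith [h.2]) _
      rw [this, zero_add]
      simp only [g2]
      rw [← mul_assoc, ← Real.exp_add]
      have hGr := hG r hr
      calc Real.exp (-(r * t)) * f r ≤ Real.exp (-(r * t)) * G r := by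
            gcongr
            exact hle r hrc
        _ ≤ _ := by
            gcongr
            nlinarith
  have hint := setIntegral_mono_on hf (hg1.add hg2) measurableSet_Ioi hpt
  have e1 : ∫ r in Ioi (0 : ℝ), g1 r = Real.exp (-(c / 2 * t)) * -(k * c ^ 2 / 8) := by
    rw [setIntegral_indicator measurableSet_Ioc,
      inter_eq_right.2 (Ioc_subset_Ioi_self : Ioc 0 (c / 2) ⊆ Ioi 0),
      ← intervalIntegral.integral_of_le (half_pos hc).le,
      intervalIntegral.integral_const_mul, intervalIntegral.integral_neg,
      intervalIntegral.integral_const_mul, integral_id]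
    ring
  have e2 : ∫ r in Ioi (0 : ℝ), g2 r =
      Real.exp (-(c / 2 * t)) * (Real.exp c * M * Real.exp (-(c / 2 * t))) := by
    simp only [g2]
    rw [integral_const_mul]
    have : Real.exp (-(c * (t - 1))) =
        Real.exp (-(c / 2 * t)) * (Real.exp c * Real.exp (-(c / 2 * t))) := by
      rw [← Real.exp_add, ← Real.exp_add]
      ring_nf
    rw [this]
    ring
  rw [integral_add' hg1 hg2, e1, e2] at hint
  nlinarith [Real.exp_pos (-(c / 2 * t))]

/-- Differentiation under the integral sign in the exponent. -/
lemma integrableOn_and_hasDerivAt_integral_kernel {γ lam α t : ℝ} (hγ : 0 < γ) (hlam : 0 < lam)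
    (hα : α ∈ Ioo (0 : ℝ) 1) (ht : 1 ≤ t) :
    IntegrableOn (fun r => Real.exp (-(r * t)) * kernelDeriv γ lam r α) (Ioi 0) ∧
    HasDerivAt (fun a : ℝ =>
        ∫ r in Ioi (0 : ℝ), Real.exp (-(r * t)) *
          ((γ / π) * (lam * r ^ a * Real.sin (a * π)) /
            ((-r + lam * γ * r ^ a * Real.cos (a * π) + lam) ^ 2
              + (lam * γ * r ^ a * Real.sin (a * π)) ^ 2)))
      (∫ r in Ioi (0 : ℝ), Real.exp (-(r * t)) * kernelDeriv γ lam r α) α := by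
  have hs := sin_mul_pi_pos hα
  set σ := Real.sin (α * π) / 2 with hσ
  have hσ0 : 0 < σ := half_pos hs
  set β := (1 + α) / 2 with hβ
  set δ := (1 - α) / 4 with hδ
  have hδ0 : 0 < δ := by have := hα.2; simp only [hδ]; linarith
  have hβ0 : 0 < β := by have := hα.1; simp only [hβ]; linarith
  have hαβ : α < β := by have := hα.2; simp only [hβ]; linarith
  have hβ1 : β < 1 := by have := hα.2; simp only [hβ]; linarith
  have hsum : β + δ < 1 := by have := hα.2; simp only [hβ, hδ]; linarith
  have hexp : ∀ r, 0 < r → Real.exp (-(r * t)) ≤ Real.exp (-r) := by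
    intro r hr
    gcongr
    nlinarith
  have hnhds : {a : ℝ | a ∈ Ioo 0 β ∧ σ < Real.sin (a * π)} ∈ 𝓝 α := by
    refine Filter.inter_mem (Ioo_mem_nhds hα.1 hαβ) ?_
    have : ContinuousAt (fun a : ℝ => Real.sin (a * π)) α := by fun_prop
    exact this.eventually_const_lt (by simp only [hσ]; linarith)
  refine hasDerivAt_integral_of_dominated_loc_of_deriv_le hnhds (.of_forall fun a => ?_) ?_
    (F' := fun a r => Real.exp (-(r * t)) * kernelDeriv γ lam r a)
    (bound := fun r => 1 / (π * lam * γ * σ ^ 2) * (Real.exp (-r) * logPowerMajorant β δ r))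
    ?_ ?_ ?_ ?_
  · exact Measurable.aestronglyMeasurable (by fun_prop)
  · refine Integrable.mono' ((integrableOn_exp_neg_mul_rpow (p := -α)
      (by linarith [hα.2])).const_mul (1 / (π * lam * γ * Real.sin (α * π))))
      (Measurable.aestronglyMeasurable (by fun_prop))
      ((ae_restrict_iff' measurableSet_Ioi).2 (.of_forall fun r (hr : 0 < r) => ?_))
    rw [Real.norm_eq_abs, abs_mul, Real.abs_exp, mul_left_comm (1 / _)]
    exact mul_le_mul (hexp r hr) (abs_kernel_le hγ hlam hr hα) (abs_nonneg _) (Real.exp_pos _).le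
  · exact ((by fun_prop : Measurable fun r : ℝ => Real.exp (-(r * t))).mul
      (measurable_kernelDeriv γ lam α)).aestronglyMeasurable
  · refine (ae_restrict_iff' measurableSet_Ioi).2 (.of_forall fun r (hr : 0 < r) a ha => ?_)
    have ha1 : a ∈ Ioo (0 : ℝ) 1 := ⟨ha.1.1, ha.1.2.trans hβ1⟩
    rw [Real.norm_eq_abs, abs_mul, Real.abs_exp, mul_left_comm (1 / _)]
    refine mul_le_mul (hexp r hr) ((abs_kernelDeriv_le hγ hlam hr ha1).trans ?_)
      (abs_nonneg _) (Real.exp_pos _).le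
    have hb := abs_log_add_pi_mul_rpow_neg_le hr hδ0 ha.1.1.le ha.1.2.le
    have := ha.2.le
    gcongr
  · exact (integrableOn_exp_neg_mul_logPowerMajorant hβ0 hδ0 hsum).const_mul _
  · refine (ae_restrict_iff' measurableSet_Ioi).2 (.of_forall fun r (hr : 0 < r) a ha => ?_)
    exact (hasDerivAt_kernel hγ hlam hr ⟨ha.1.1, ha.1.2.trans hβ1⟩).const_mul _

/-- Main Lemma: for `t₀` large enough, `∂_α B_α(λ, t₀) < 0` for all `λ ≥ lam1`. -/
theorem main_lemma (γ lam1 α : ℝ)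
    (hγ : 0 < γ) (hlam1 : 0 < lam1) (hα : α ∈ Ioo (0:ℝ) 1) :
    ∃ T₀ : ℝ, 1 ≤ T₀ ∧ ∀ t₀ : ℝ, T₀ ≤ t₀ → ∀ lam : ℝ, lam1 ≤ lam →
      deriv (fun a : ℝ =>
        ∫ r in Ioi (0:ℝ), Real.exp (-(r * t₀)) *
          ((γ / π) * (lam * r ^ a * Real.sin (a * π)) /
            ((-r + lam * γ * r ^ a * Real.cos (a * π) + lam) ^ 2
              + (lam * γ * r ^ a * Real.sin (a * π)) ^ 2))) α < 0 := by
  have hs := sin_mul_pi_pos hα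
  obtain ⟨c, hc, k, hk, hneg⟩ := exists_kernelDeriv_le_neg hγ hlam1 hα
  have hδ : 0 < (1 - α) / 2 := by linarith [hα.2]
  let C : ℝ := 1 / (π * γ * Real.sin (α * π) ^ 2)
  have hC : 0 < C := by positivity
  let G : ℝ → ℝ := fun r => C * logPowerMajorant α ((1 - α) / 2) r
  have hGi : IntegrableOn (fun r => Real.exp (-r) * G r) (Ioi 0) := by
    simp only [G, mul_left_comm _ C]
    exact (integrableOn_exp_neg_mul_logPowerMajorant hα.1 hδ (by linarith [hα.2])).const_mul _
  obtain ⟨T, hT1, hT⟩ := exists_forall_integral_exp_mul_neg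
    (fun r hr => mul_nonneg hC.le (logPowerMajorant_nonneg hr hδ)) hGi hc hk
  refine ⟨T, hT1, fun t ht lam hlam => ?_⟩
  have hl : 0 < lam := hlam1.trans_le hlam
  obtain ⟨hint, hderiv⟩ :=
    integrableOn_and_hasDerivAt_integral_kernel hγ hl hα (hT1.trans ht)
  rw [hderiv.deriv]
  have key := hT t ht (fun r => lam * kernelDeriv γ lam r α)
    (by simp only [mul_left_comm _ lam]; exact hint.const_mul lam) ?_ ?_
  · simp only [mul_left_comm _ lam, integral_const_mul] at key
    exact neg_of_mul_neg_right key hl.le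
  · intro r hr
    have := hneg r hr lam hlam
    rwa [le_div_iff₀' hl] at this
  · intro r hcr
    have hr : 0 < r := hc.trans_le hcr
    have h1 := (le_abs_self _).trans (abs_kernelDeriv_le hγ hl hr hα)
    calc lam * kernelDeriv γ lam r α
        ≤ lam * (1 / (π * lam * γ * Real.sin (α * π) ^ 2) *
            ((|Real.log r| + π) * r ^ (-α))) := by gcongr
      _ = C * ((|Real.log r| + π) * r ^ (-α)) := by
          simp only [C]
          field_simp
      _ ≤ G r := by
          have := abs_log_add_pi_mul_rpow_neg_le hr hδ hα.1.le le_rfl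
          simp only [G]
          gcongr
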